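/- Let R be a coherent commutative ring. The following statements are equivalent: (1) R is G-semihereditary, i.e., every submodule of a flat R-module is Gorenstein flat; (2) Gfd_R(M) ≤ 1 for all finitely presented R-modules M; (3) Gpd_R(M) ≤ 1 for all finitely presented R-modules M; (4) every finitely generated ideal of R is Gorenstein flat; (5) fd_R(I) ≤ 1 for all injective R-modules I; (6) FP-id_R(F) ≤ 1 for all flat R-modules F; (7) fd_R(E) ≤ 1 for all FP-injective R-modules E. -/

import Mathlib

noncomputable section

universe u

variable (R : Type u) [CommRing R]

/-- `IsShortExact R f g` says that `0 → A → B → C → 0` is a short exact sequence. -/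
def IsShortExact {A B C : Type u} [AddCommGroup A] [Module R A] [AddCommGroup B] [Module R B]
    [AddCommGroup C] [Module R C] (f : A →ₗ[R] B) (g : B →ₗ[R] C) : Prop :=
  Function.Injective f ∧ Function.Surjective g ∧ LinearMap.range f = LinearMap.ker g

/-- A module `M` is Gorenstein projective if there is a complete projective resolution
`⋯ → P i → P (i+1) → ⋯` (an exact sequence of projective modules which remains exact after
applying `Hom(-, Q)` for every projective module `Q`) with `M ≅ Im (P 0 → P 1)`. -/
def IsGorensteinProjective (M : Type u) [AddCommGroup M] [Module R M] : Prop :=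
  ∃ (P : ℤ → Type u) (_ : ∀ i, AddCommGroup (P i)) (_ : ∀ i, Module R (P i))
    (d : ∀ i, P i →ₗ[R] P (i + 1)),
    (∀ i, Module.Projective R (P i)) ∧
    (∀ i, LinearMap.range (d i) = LinearMap.ker (d (i + 1))) ∧
    Nonempty (M ≃ₗ[R] LinearMap.range (d 0)) ∧
    (∀ (Q : Type u) (_ : AddCommGroup Q) (_ : Module R Q), Module.Projective R Q →
      ∀ (i : ℤ) (g : P (i + 1) →ₗ[R] Q), g.comp (d i) = 0 →
        ∃ h : P (i + 1 + 1) →ₗ[R] Q, h.comp (d (i + 1)) = g)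

/-- A module `M` is strongly Gorenstein projective if there is a complete projective
resolution of the form `⋯ → P →f P →f P → ⋯` with `M ≅ Im f`. -/
def IsStronglyGorensteinProjective (M : Type u) [AddCommGroup M] [Module R M] : Prop :=
  ∃ (P : Type u) (_ : AddCommGroup P) (_ : Module R P) (f : P →ₗ[R] P),
    Module.Projective R P ∧
    LinearMap.range f = LinearMap.ker f ∧
    Nonempty (M ≃ₗ[R] LinearMap.range f) ∧
    (∀ (Q : Type u) (_ : AddCommGroup Q) (_ : Module R Q), Module.Projective R Q →
      ∀ g : P →ₗ[R] Q, g.comp f = 0 → ∃ h : P →ₗ[R] Q, h.comp f = g)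

/-- A module `M` is Gorenstein flat if there is an exact sequence of flat modules
`⋯ → F i → F (i+1) → ⋯` which remains exact after applying `- ⊗ I` for every injective
module `I`, with `M ≅ Im (F 0 → F 1)`. -/
def IsGorensteinFlat (M : Type u) [AddCommGroup M] [Module R M] : Prop :=
  ∃ (F : ℤ → Type u) (_ : ∀ i, AddCommGroup (F i)) (_ : ∀ i, Module R (F i))
    (d : ∀ i, F i →ₗ[R] F (i + 1)),
    (∀ i, Module.Flat R (F i)) ∧
    (∀ i, LinearMap.range (d i) = LinearMap.ker (d (i + 1))) ∧
    Nonempty (M ≃ₗ[R] LinearMap.range (d 0)) ∧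
    (∀ (I : Type u) (_ : AddCommGroup I) (_ : Module R I), Module.Injective R I →
      ∀ i : ℤ, LinearMap.range (LinearMap.rTensor I (d i)) =
        LinearMap.ker (LinearMap.rTensor I (d (i + 1))))

/-- A module `M` is strongly Gorenstein flat if there is an exact sequence of flat modules
of the form `⋯ → F →f F →f F → ⋯` which remains exact after applying `- ⊗ I` for every
injective module `I`, with `M ≅ Im f`. -/
def IsStronglyGorensteinFlat (M : Type u) [AddCommGroup M] [Module R M] : Prop :=
  ∃ (F : Type u) (_ : AddCommGroup F) (_ : Module R F) (f : F →ₗ[R] F),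
    Module.Flat R F ∧
    LinearMap.range f = LinearMap.ker f ∧
    Nonempty (M ≃ₗ[R] LinearMap.range f) ∧
    (∀ (I : Type u) (_ : AddCommGroup I) (_ : Module R I), Module.Injective R I →
      LinearMap.range (LinearMap.rTensor I f) = LinearMap.ker (LinearMap.rTensor I f))

/-- `ProjDimLE R M n` : the projective dimension of `M` is at most `n`, i.e. there is an exact
sequence `0 → P n → ⋯ → P 0 → M → 0` with each `P i` projective. -/
def ProjDimLE (M : Type u) [AddCommGroup M] [Module R M] (n : ℕ) : Prop :=
  ∃ (P : ℕ → Type u) (_ : ∀ i, AddCommGroup (P i)) (_ : ∀ i, Module R (P i))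
    (d : ∀ i, P (i + 1) →ₗ[R] P i) (ε : P 0 →ₗ[R] M),
    (∀ i, Module.Projective R (P i)) ∧
    (∀ i, n < i → Subsingleton (P i)) ∧
    Function.Surjective ε ∧
    LinearMap.ker ε = LinearMap.range (d 0) ∧
    (∀ i, LinearMap.ker (d i) = LinearMap.range (d (i + 1)))

/-- `InjDimLE R M n` : the injective dimension of `M` is at most `n`, i.e. there is an exact
sequence `0 → M → E 0 → ⋯ → E n → 0` with each `E i` injective. -/
def InjDimLE (M : Type u) [AddCommGroup M] [Module R M] (n : ℕ) : Prop :=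
  ∃ (E : ℕ → Type u) (_ : ∀ i, AddCommGroup (E i)) (_ : ∀ i, Module R (E i))
    (d : ∀ i, E i →ₗ[R] E (i + 1)) (η : M →ₗ[R] E 0),
    (∀ i, Module.Injective R (E i)) ∧
    (∀ i, n < i → Subsingleton (E i)) ∧
    Function.Injective η ∧
    LinearMap.range η = LinearMap.ker (d 0) ∧
    (∀ i, LinearMap.range (d i) = LinearMap.ker (d (i + 1)))

/-- `FlatDimLE R M n` : the flat dimension of `M` is at most `n`. -/
def FlatDimLE (M : Type u) [AddCommGroup M] [Module R M] (n : ℕ) : Prop :=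
  ∃ (F : ℕ → Type u) (_ : ∀ i, AddCommGroup (F i)) (_ : ∀ i, Module R (F i))
    (d : ∀ i, F (i + 1) →ₗ[R] F i) (ε : F 0 →ₗ[R] M),
    (∀ i, Module.Flat R (F i)) ∧
    (∀ i, n < i → Subsingleton (F i)) ∧
    Function.Surjective ε ∧
    LinearMap.ker ε = LinearMap.range (d 0) ∧
    (∀ i, LinearMap.ker (d i) = LinearMap.range (d (i + 1)))

/-- `GProjDimLE R M n` : the Gorenstein projective dimension of `M` is at most `n`, i.e.
there is an exact sequence `0 → G n → ⋯ → G 0 → M → 0` with each `G i` Gorenstein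
projective. -/
def GProjDimLE (M : Type u) [AddCommGroup M] [Module R M] (n : ℕ) : Prop :=
  ∃ (G : ℕ → Type u) (_ : ∀ i, AddCommGroup (G i)) (_ : ∀ i, Module R (G i))
    (d : ∀ i, G (i + 1) →ₗ[R] G i) (ε : G 0 →ₗ[R] M),
    (∀ i, IsGorensteinProjective R (G i)) ∧
    (∀ i, n < i → Subsingleton (G i)) ∧
    Function.Surjective ε ∧
    LinearMap.ker ε = LinearMap.range (d 0) ∧
    (∀ i, LinearMap.ker (d i) = LinearMap.range (d (i + 1)))

/-- `GFlatDimLE R M n` : the Gorenstein flat dimension of `M` is at most `n`. -/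
def GFlatDimLE (M : Type u) [AddCommGroup M] [Module R M] (n : ℕ) : Prop :=
  ∃ (G : ℕ → Type u) (_ : ∀ i, AddCommGroup (G i)) (_ : ∀ i, Module R (G i))
    (d : ∀ i, G (i + 1) →ₗ[R] G i) (ε : G 0 →ₗ[R] M),
    (∀ i, IsGorensteinFlat R (G i)) ∧
    (∀ i, n < i → Subsingleton (G i)) ∧
    Function.Surjective ε ∧
    LinearMap.ker ε = LinearMap.range (d 0) ∧
    (∀ i, LinearMap.ker (d i) = LinearMap.range (d (i + 1)))

/-- A module is finitely presented if it is the quotient of a finite free module by a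
finitely generated submodule of relations. -/
def IsFinitelyPresented (M : Type u) [AddCommGroup M] [Module R M] : Prop :=
  ∃ (n : ℕ) (f : (Fin n → R) →ₗ[R] M), Function.Surjective f ∧ (LinearMap.ker f).FG

/-- A ring is coherent if every finitely generated ideal is finitely presented. -/
def IsCoherentRing : Prop :=
  ∀ I : Ideal R, I.FG → IsFinitelyPresented R I

/-- `ExtVanishes R M N i` : `Ext_R^i(M, N) = 0`. -/
def ExtVanishes (M N : Type u) [AddCommGroup M] [Module R M] [AddCommGroup N] [Module R N]
    (i : ℕ) : Prop :=
  Subsingleton (((Ext R (ModuleCat.{u} R) i).obj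
    (Opposite.op (ModuleCat.of R M))).obj (ModuleCat.of R N))

/-- A ring is hereditary if every submodule of a projective module is projective. -/
def IsHereditaryRing : Prop :=
  ∀ (P : Type u) (_ : AddCommGroup P) (_ : Module R P), Module.Projective R P →
    ∀ N : Submodule R P, Module.Projective R N

/-- A ring is semihereditary if every finitely generated ideal is projective. -/
def IsSemihereditaryRing : Prop :=
  ∀ I : Ideal R, I.FG → Module.Projective R I

/-- A ring is Gorenstein hereditary if every submodule of a projective module is
Gorenstein projective. -/
def IsGHereditaryRing : Prop :=
  ∀ (P : Type u) (_ : AddCommGroup P) (_ : Module R P), Module.Projective R P →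
    ∀ N : Submodule R P, IsGorensteinProjective R N

/-- A ring is strongly Gorenstein hereditary if every submodule of a projective module is
strongly Gorenstein projective. -/
def IsSGHereditaryRing : Prop :=
  ∀ (P : Type u) (_ : AddCommGroup P) (_ : Module R P), Module.Projective R P →
    ∀ N : Submodule R P, IsStronglyGorensteinProjective R N

/-- A ring is Gorenstein semihereditary if it is coherent and every submodule of a flat
module is Gorenstein flat. -/
def IsGSemihereditaryRing : Prop :=
  IsCoherentRing R ∧
    ∀ (F : Type u) (_ : AddCommGroup F) (_ : Module R F), Module.Flat R F →
      ∀ N : Submodule R F, IsGorensteinFlat R N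

/-- A ring is strongly Gorenstein semihereditary if it is coherent and every submodule of a
flat module is strongly Gorenstein flat. -/
def IsSGSemihereditaryRing : Prop :=
  IsCoherentRing R ∧
    ∀ (F : Type u) (_ : AddCommGroup F) (_ : Module R F), Module.Flat R F →
      ∀ N : Submodule R F, IsStronglyGorensteinFlat R N

section ExtBridge

open CategoryTheory

variable {R}

theorem extVanishes_succ_iff (M N : Type u) [AddCommGroup M] [Module R M] [AddCommGroup N]
    [Module R N] (n : ℕ) :
    ExtVanishes R M N (n + 1) ↔
      Subsingleton (Abelian.Ext (ModuleCat.of R M) (ModuleCat.of R N) (n + 1)) := by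
  let P := projectiveResolution (ModuleCat.of R M)
  have h₁ : ExtVanishes R M N (n + 1) ↔
      (P.complex.linearYonedaObj R (ModuleCat.of R N)).ExactAt (n + 1) := by
    unfold ExtVanishes
    rw [HomologicalComplex.exactAt_iff_isZero_homology,
      ← (P.isoExt (R := R) (n + 1) (ModuleCat.of R N)).isZero_iff,
      ModuleCat.isZero_iff_subsingleton]
  rw [h₁, HomologicalComplex.exactAt_iff' _ n (n + 1) (n + 2) (by simp) (by simp),
    ShortComplex.moduleCat_exact_iff]
  constructor
  · intro h
    refine subsingleton_of_forall_eq 0 fun α => ?_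
    obtain ⟨f, hf, rfl⟩ := P.extMk_surjective α (n + 2) rfl
    rw [P.extMk_eq_zero_iff f (n + 2) rfl hf n rfl]
    obtain ⟨g, hg⟩ := h f hf
    exact ⟨g, hg⟩
  · intro h f hf
    exact (P.extMk_eq_zero_iff f (n + 2) rfl hf n rfl).1 (Subsingleton.elim _ _)

variable {A B C : Type u} [AddCommGroup A] [Module R A] [AddCommGroup B] [Module R B]
  [AddCommGroup C] [Module R C] {f : A →ₗ[R] B} {g : B →ₗ[R] C}

/-- The short complex in `ModuleCat R` attached to an exact pair of linear maps. -/
abbrev shortComplexOfExact (h : Function.Exact f g) : ShortComplex (ModuleCat.{u} R) :=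
  ShortComplex.mk (ModuleCat.ofHom f) (ModuleCat.ofHom g) (by
    ext x
    exact h.apply_apply_eq_zero x)

theorem shortExact_shortComplexOfExact (hf : Function.Injective f) (hg : Function.Surjective g)
    (h : Function.Exact f g) : (shortComplexOfExact h).ShortExact where
  exact := by
    rw [ShortComplex.ShortExact.moduleCat_exact_iff_function_exact]
    exact h
  mono_f := (ModuleCat.mono_iff_injective _).2 hf
  epi_g := (ModuleCat.epi_iff_surjective _).2 hg

theorem exists_extension_of_ext_one (hf : Function.Injective f) (hg : Function.Surjective g)
    (h : Function.Exact f g) (N : Type u) [AddCommGroup N] [Module R N]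
    (hC : Subsingleton (Abelian.Ext (ModuleCat.of R C) (ModuleCat.of R N) 1)) (φ : A →ₗ[R] N) :
    ∃ ψ : B →ₗ[R] N, ψ ∘ₗ f = φ := by
  have hS := shortExact_shortComplexOfExact hf hg h
  obtain ⟨x, hx⟩ := Abelian.Ext.contravariant_sequence_exact₁ hS (ModuleCat.of R N)
    (Abelian.Ext.mk₀ (ModuleCat.ofHom φ)) (n₁ := 1) rfl (hC.elim _ _)
  obtain ⟨ψ, rfl⟩ := Abelian.Ext.addEquiv₀.symm.surjective x
  refine ⟨ψ.hom, ?_⟩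
  simp only [Abelian.Ext.addEquiv₀_symm_apply, Abelian.Ext.mk₀_comp_mk₀] at hx
  have := (Abelian.Ext.mk₀_bijective _ _).1 hx
  exact congrArg ModuleCat.Hom.hom this

theorem subsingleton_ext_one_of_exists_extension (hf : Function.Injective f)
    (hg : Function.Surjective g) (h : Function.Exact f g) (N : Type u) [AddCommGroup N]
    [Module R N] (hB : Subsingleton (Abelian.Ext (ModuleCat.of R B) (ModuleCat.of R N) 1))
    (hφ : ∀ φ : A →ₗ[R] N, ∃ ψ : B →ₗ[R] N, ψ ∘ₗ f = φ) :
    Subsingleton (Abelian.Ext (ModuleCat.of R C) (ModuleCat.of R N) 1) := by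
  have hS := shortExact_shortComplexOfExact hf hg h
  refine subsingleton_of_forall_eq 0 fun x => ?_
  obtain ⟨y, rfl⟩ := Abelian.Ext.contravariant_sequence_exact₃ hS (ModuleCat.of R N) x
    (hB.elim _ _) (n₀ := 0) rfl
  obtain ⟨φ, rfl⟩ := Abelian.Ext.addEquiv₀.symm.surjective y
  obtain ⟨ψ, hψ⟩ := hφ φ.hom
  have : φ = (shortComplexOfExact h).f ≫ ModuleCat.ofHom ψ := by
    ext x
    exact (LinearMap.congr_fun hψ x).symm
  subst this
  rw [Abelian.Ext.addEquiv₀_symm_apply, ← Abelian.Ext.mk₀_comp_mk₀,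
    ← Abelian.Ext.comp_assoc _ _ _ (add_zero 1) (zero_add 0) rfl, hS.extClass_comp,
    Abelian.Ext.zero_comp]

theorem subsingleton_ext_left (hf : Function.Injective f)
    (hg : Function.Surjective g) (h : Function.Exact f g) (N : Type u) [AddCommGroup N]
    [Module R N] (n : ℕ)
    (hB : Subsingleton (Abelian.Ext (ModuleCat.of R B) (ModuleCat.of R N) n))
    (hC : Subsingleton (Abelian.Ext (ModuleCat.of R C) (ModuleCat.of R N) (n + 1))) :
    Subsingleton (Abelian.Ext (ModuleCat.of R A) (ModuleCat.of R N) n) := by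
  have hS := shortExact_shortComplexOfExact hf hg h
  refine subsingleton_of_forall_eq 0 fun x => ?_
  obtain ⟨y, rfl⟩ := Abelian.Ext.contravariant_sequence_exact₁ hS (ModuleCat.of R N)
    x (add_comm 1 n) (hC.elim _ _)
  rw [hB.elim y 0, Abelian.Ext.comp_zero]

theorem subsingleton_ext_right (hf : Function.Injective f)
    (hg : Function.Surjective g) (h : Function.Exact f g) (N : Type u) [AddCommGroup N]
    [Module R N] (n : ℕ)
    (hA : Subsingleton (Abelian.Ext (ModuleCat.of R A) (ModuleCat.of R N) n))
    (hB : Subsingleton (Abelian.Ext (ModuleCat.of R B) (ModuleCat.of R N) (n + 1))) :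
    Subsingleton (Abelian.Ext (ModuleCat.of R C) (ModuleCat.of R N) (n + 1)) := by
  have hS := shortExact_shortComplexOfExact hf hg h
  refine subsingleton_of_forall_eq 0 fun x => ?_
  obtain ⟨y, rfl⟩ := Abelian.Ext.contravariant_sequence_exact₃ hS (ModuleCat.of R N) x
    (hB.elim _ _) (add_comm 1 n)
  rw [hA.elim y 0, Abelian.Ext.comp_zero]

theorem subsingleton_ext_of_projective (P N : Type u) [AddCommGroup P] [Module R P]
    [AddCommGroup N] [Module R N] [Module.Projective R P] (n : ℕ) :
    Subsingleton (Abelian.Ext (ModuleCat.of R P) (ModuleCat.of R N) (n + 1)) :=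
  have : Projective (ModuleCat.of R P) := ModuleCat.projective_of_categoryTheory_projective _
  Abelian.Ext.subsingleton_of_projective _ _ _

theorem subsingleton_ext_of_injective (M I : Type u) [AddCommGroup M] [Module R M]
    [AddCommGroup I] [Module R I] [Module.Injective R I] (n : ℕ) :
    Subsingleton (Abelian.Ext (ModuleCat.of R M) (ModuleCat.of R I) (n + 1)) :=
  have : Injective (ModuleCat.of R I) := Module.injective_object_of_injective_module R I
  Abelian.Ext.subsingleton_of_injective _ _ _

end ExtBridge

section Tor

open TensorProduct

variable {R}
variable {A X N K F I : Type u} [AddCommGroup A] [Module R A] [AddCommGroup X] [Module R X]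
  [AddCommGroup N] [Module R N] [AddCommGroup K] [Module R K] [AddCommGroup F] [Module R F]
  [AddCommGroup I] [Module R I]
  {f : A →ₗ[R] X} {g : X →ₗ[R] N} {k : K →ₗ[R] F} {l : F →ₗ[R] I}

theorem rTensor_injective_of_lTensor_injective (hf : Function.Injective f)
    (hfg : Function.Exact f g) (hg : Function.Surjective g) (hkl : Function.Exact k l)
    (hl : Function.Surjective l) [Module.Flat R F] (h : Function.Injective (k.lTensor N)) :
    Function.Injective (f.rTensor I) := by
  rw [injective_iff_map_eq_zero]
  intro z hz
  obtain ⟨w, rfl⟩ := LinearMap.lTensor_surjective A hl z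
  have h₁ : l.lTensor X (f.rTensor F w) = 0 := by
    rw [← LinearMap.comp_apply, LinearMap.lTensor_comp_rTensor, ← LinearMap.rTensor_comp_lTensor,
      LinearMap.comp_apply, hz]
  obtain ⟨v, hv⟩ := (lTensor_exact X hkl hl _).1 h₁
  have h₂ : g.rTensor K v = 0 := by
    apply h
    rw [← LinearMap.comp_apply, LinearMap.lTensor_comp_rTensor, ← LinearMap.rTensor_comp_lTensor,
      LinearMap.comp_apply, hv, map_zero]
    exact (rTensor_exact F hfg hg).apply_apply_eq_zero w
  obtain ⟨v', rfl⟩ := (rTensor_exact K hfg hg _).1 h₂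
  have h₃ : k.lTensor A v' = w := by
    apply Module.Flat.rTensor_preserves_injective_linearMap (M := F) f hf
    rw [← hv, ← LinearMap.comp_apply, LinearMap.rTensor_comp_lTensor,
      ← LinearMap.lTensor_comp_rTensor, LinearMap.comp_apply]
  rw [← h₃]
  exact (lTensor_exact A hkl hl).apply_apply_eq_zero v'

theorem lTensor_injective_of_rTensor_injective (hfg : Function.Exact f g)
    (hg : Function.Surjective g) (hk : Function.Injective k) (hkl : Function.Exact k l)
    (hl : Function.Surjective l) [Module.Flat R X] (h : Function.Injective (f.rTensor I)) :
    Function.Injective (k.lTensor N) := by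
  rw [LinearMap.lTensor_inj_iff_rTensor_inj]
  rw [← LinearMap.lTensor_inj_iff_rTensor_inj] at h
  exact rTensor_injective_of_lTensor_injective hk hkl hl hfg hg h

variable (R N I) in
/-- `TorOneVanishes R N I` says that `Tor₁(N, I) = 0`: tensoring with `N` preserves the
injectivity of the first map of every short exact sequence ending in `I`. -/
def TorOneVanishes : Prop :=
  ∀ (K F : Type u) [AddCommGroup K] [Module R K] [AddCommGroup F] [Module R F]
    (k : K →ₗ[R] F) (l : F →ₗ[R] I), Function.Injective k → Function.Exact k l →
    Function.Surjective l → Function.Injective (k.lTensor N)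

theorem torOneVanishes_of_rTensor_injective (hfg : Function.Exact f g)
    (hg : Function.Surjective g) [Module.Flat R X] (h : Function.Injective (f.rTensor I)) :
    TorOneVanishes R N I :=
  fun _ _ _ _ _ _ _ _ hk hkl hl => lTensor_injective_of_rTensor_injective hfg hg hk hkl hl h

variable (R N) in
theorem exists_free_presentation :
    ∃ (K F : Type u) (_ : AddCommGroup K) (_ : Module R K) (_ : AddCommGroup F) (_ : Module R F)
      (k : K →ₗ[R] F) (l : F →ₗ[R] N), Module.Free R F ∧ Function.Injective k ∧
      Function.Exact k l ∧ Function.Surjective l :=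
  let l : (N →₀ R) →ₗ[R] N := Finsupp.linearCombination R id
  ⟨LinearMap.ker l, N →₀ R, inferInstance, inferInstance, inferInstance, inferInstance,
    (LinearMap.ker l).subtype, l, inferInstance, Submodule.injective_subtype _,
    LinearMap.exact_subtype_ker_map l, fun x => ⟨Finsupp.single x 1, by simp [l]⟩⟩

theorem TorOneVanishes.rTensor_injective (h : TorOneVanishes R N I) (hf : Function.Injective f)
    (hfg : Function.Exact f g) (hg : Function.Surjective g) :
    Function.Injective (f.rTensor I) := by
  obtain ⟨K, F, _, _, _, _, k, l, _, hk, hkl, hl⟩ := exists_free_presentation R I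
  exact rTensor_injective_of_lTensor_injective hf hfg hg hkl hl (h _ _ k l hk hkl hl)

theorem torOneVanishes_of_lTensor_injective (hkl : Function.Exact k l)
    (hl : Function.Surjective l) [Module.Flat R F] (h : Function.Injective (k.lTensor N)) :
    TorOneVanishes R N I := by
  obtain ⟨A, X, _, _, _, _, f, g, _, hf, hfg, hg⟩ := exists_free_presentation R N
  exact torOneVanishes_of_rTensor_injective hfg hg
    (rTensor_injective_of_lTensor_injective hf hfg hg hkl hl h)

theorem TorOneVanishes.symm (h : TorOneVanishes R N I) : TorOneVanishes R I N := by
  intro K F _ _ _ _ k l hk hkl hl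
  rw [LinearMap.lTensor_inj_iff_rTensor_inj]
  exact h.rTensor_injective hk hkl hl

theorem torOneVanishes_of_flat_left [Module.Flat R N] : TorOneVanishes R N I :=
  fun _ _ _ _ _ _ k _ hk _ _ => Module.Flat.lTensor_preserves_injective_linearMap k hk

theorem flat_of_torOneVanishes
    (h : ∀ J : Ideal R, J.FG → TorOneVanishes R (R ⧸ J) K) : Module.Flat R K := by
  rw [Module.Flat.iff_rTensor_injective]
  intro J hJ
  exact (h J hJ).rTensor_injective (Submodule.injective_subtype J)
    (LinearMap.exact_subtype_mkQ J) (Submodule.mkQ_surjective J)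

theorem TorOneVanishes.of_exact {B C : Type u} [AddCommGroup B] [Module R B] [AddCommGroup C]
    [Module R C] {f : A →ₗ[R] B} {g : B →ₗ[R] C} (hf : Function.Injective f)
    (hfg : Function.Exact f g) (hg : Function.Surjective g) (hA : TorOneVanishes R A I)
    (hC : TorOneVanishes R C I) : TorOneVanishes R B I := by
  obtain ⟨K, F, _, _, _, _, k, l, _, hk, hkl, hl⟩ := exists_free_presentation R I
  refine torOneVanishes_of_lTensor_injective hkl hl ?_
  rw [injective_iff_map_eq_zero]
  intro x hx
  have h₁ : g.rTensor _ x = 0 := by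
    apply hC _ _ k _ hk hkl hl
    rw [← LinearMap.comp_apply, LinearMap.lTensor_comp_rTensor, ← LinearMap.rTensor_comp_lTensor,
      LinearMap.comp_apply, hx]
    simp
  obtain ⟨y, rfl⟩ := (rTensor_exact _ hfg hg _).1 h₁
  have h₂ : y = 0 := by
    apply hA _ _ k _ hk hkl hl
    apply Module.Flat.rTensor_preserves_injective_linearMap f hf
    rw [← LinearMap.comp_apply, LinearMap.rTensor_comp_lTensor, ← LinearMap.lTensor_comp_rTensor,
      LinearMap.comp_apply, hx]
    simp
  rw [h₂, map_zero]

theorem TorOneVanishes.shift {H P M : Type u} [AddCommGroup H] [Module R H] [AddCommGroup P]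
    [Module R P] [AddCommGroup M] [Module R M] {i : H →ₗ[R] P} {p : P →ₗ[R] M}
    (hi : Function.Injective i) (hip : Function.Exact i p) (hp : Function.Surjective p)
    [Module.Flat R P] (hk : Function.Injective k) (hkl : Function.Exact k l)
    (hl : Function.Surjective l) [Module.Flat R F] (h : TorOneVanishes R H I) :
    TorOneVanishes R M K := by
  refine torOneVanishes_of_rTensor_injective hip hp (.of_comp (f := k.lTensor P) ?_)
  rw [← LinearMap.coe_comp, LinearMap.lTensor_comp_rTensor, ← LinearMap.rTensor_comp_lTensor,
    LinearMap.coe_comp]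
  exact (Module.Flat.rTensor_preserves_injective_linearMap i hi).comp (h _ _ k l hk hkl hl)

/-- A submodule of a flat module has no `Tor₁` against modules of flat dimension at most one. -/
theorem torOneVanishes_of_injective_of_flat (hk : Function.Injective k)
    (hkl : Function.Exact k l) (hl : Function.Surjective l) [Module.Flat R K] [Module.Flat R F]
    [Module.Flat R X] {j : N →ₗ[R] X} (hj : Function.Injective j) : TorOneVanishes R N I :=
  (TorOneVanishes.shift hk hkl hl hj (LinearMap.exact_map_mkQ_range j)
    (Submodule.mkQ_surjective _) (torOneVanishes_of_flat_left (N := K)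
      (I := X ⧸ LinearMap.range j))).symm

theorem flat_of_exact {B C : Type u} [AddCommGroup B] [Module R B] [AddCommGroup C]
    [Module R C] {f : A →ₗ[R] B} {g : B →ₗ[R] C} (hf : Function.Injective f)
    (hfg : Function.Exact f g) (hg : Function.Surjective g) [Module.Flat R A] [Module.Flat R C] :
    Module.Flat R B :=
  flat_of_torOneVanishes fun _ _ => (TorOneVanishes.of_exact hf hfg hg
    torOneVanishes_of_flat_left torOneVanishes_of_flat_left).symm

end Tor

section Dimension

variable {R}

/-- The terms of a resolution `0 → K → F`, indexed by degree. -/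
def LengthOneTerm (F K : Type u) : ℕ → Type u
  | 0 => F
  | 1 => K
  | _ + 2 => PUnit

instance (F K : Type u) [AddCommGroup F] [AddCommGroup K] :
    ∀ i, AddCommGroup (LengthOneTerm F K i)
  | 0 => inferInstanceAs (AddCommGroup F)
  | 1 => inferInstanceAs (AddCommGroup K)
  | _ + 2 => inferInstanceAs (AddCommGroup PUnit.{u + 1})

instance (F K : Type u) [AddCommGroup F] [AddCommGroup K] [Module R F] [Module R K] :
    ∀ i, Module R (LengthOneTerm F K i)
  | 0 => inferInstanceAs (Module R F)
  | 1 => inferInstanceAs (Module R K)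
  | _ + 2 => inferInstanceAs (Module R PUnit.{u + 1})

/-- The differentials of a resolution `0 → K → F`. -/
def lengthOneDifferential {F K : Type u} [AddCommGroup F] [AddCommGroup K] [Module R F]
    [Module R K] (k : K →ₗ[R] F) : ∀ i, LengthOneTerm F K (i + 1) →ₗ[R] LengthOneTerm F K i
  | 0 => k
  | _ + 1 => 0

variable {C : ∀ (M : Type u) [AddCommGroup M] [Module R M], Prop}
variable {M K F : Type u} [AddCommGroup M] [Module R M] [AddCommGroup K] [Module R K]
  [AddCommGroup F] [Module R F]

theorem exists_resolution_of_exact (hK : C K) (hF : C F) (hzero : C PUnit.{u + 1})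
    {k : K →ₗ[R] F} {l : F →ₗ[R] M} (hk : Function.Injective k) (hkl : Function.Exact k l)
    (hl : Function.Surjective l) :
    ∃ (P : ℕ → Type u) (_ : ∀ i, AddCommGroup (P i)) (_ : ∀ i, Module R (P i))
      (d : ∀ i, P (i + 1) →ₗ[R] P i) (ε : P 0 →ₗ[R] M),
      (∀ i, C (P i)) ∧ (∀ i, 1 < i → Subsingleton (P i)) ∧ Function.Surjective ε ∧
      LinearMap.ker ε = LinearMap.range (d 0) ∧
      (∀ i, LinearMap.ker (d i) = LinearMap.range (d (i + 1))) := by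
  have hsub (i : ℕ) : Subsingleton (LengthOneTerm F K (i + 2)) :=
    inferInstanceAs (Subsingleton PUnit)
  refine ⟨LengthOneTerm F K, inferInstance, inferInstance, lengthOneDifferential k, l,
    fun | 0 => hF | 1 => hK | _ + 2 => hzero,
    fun | 0, h => by omega | 1, h => by omega | i + 2, _ => hsub i, hl, hkl.linearMap_ker_eq,
    fun i => ?_⟩
  have hrange : LinearMap.range (lengthOneDifferential (R := R) k (i + 1)) = ⊥ :=
    LinearMap.range_eq_bot.2 (LinearMap.ext fun x => by
      rw [(hsub i).elim x 0, map_zero, map_zero])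
  rw [hrange]
  match i with
  | 0 => exact LinearMap.ker_eq_bot.2 hk
  | i + 1 =>
    have := hsub i
    exact LinearMap.ker_eq_bot.2 (Function.injective_of_subsingleton _)

theorem exists_exact_of_resolution
    (h : ∃ (P : ℕ → Type u) (_ : ∀ i, AddCommGroup (P i)) (_ : ∀ i, Module R (P i))
      (d : ∀ i, P (i + 1) →ₗ[R] P i) (ε : P 0 →ₗ[R] M),
      (∀ i, C (P i)) ∧ (∀ i, 1 < i → Subsingleton (P i)) ∧ Function.Surjective ε ∧
      LinearMap.ker ε = LinearMap.range (d 0) ∧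
      (∀ i, LinearMap.ker (d i) = LinearMap.range (d (i + 1)))) :
    ∃ (K F : Type u) (_ : AddCommGroup K) (_ : Module R K) (_ : AddCommGroup F) (_ : Module R F)
      (k : K →ₗ[R] F) (l : F →ₗ[R] M), C K ∧ C F ∧ Function.Injective k ∧
      Function.Exact k l ∧ Function.Surjective l := by
  obtain ⟨P, _, _, d, ε, hC, hsub, hε, hεd, hd⟩ := h
  refine ⟨P 1, P 0, inferInstance, inferInstance, inferInstance, inferInstance, d 0, ε, hC 1,
    hC 0, ?_, LinearMap.exact_iff.2 hεd, hε⟩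
  have := hsub 2 one_lt_two
  rw [← LinearMap.ker_eq_bot, hd, LinearMap.range_eq_bot]
  exact LinearMap.ext fun x => by rw [Subsingleton.elim x 0, map_zero, map_zero]

theorem flatDimLE_one_of_exact [Module.Flat R K] [Module.Flat R F] {k : K →ₗ[R] F}
    {l : F →ₗ[R] M} (hk : Function.Injective k) (hkl : Function.Exact k l)
    (hl : Function.Surjective l) : FlatDimLE R M 1 := by
  have := exists_resolution_of_exact (C := fun M _ _ => Module.Flat R M) ‹_› ‹_› inferInstance
    hk hkl hl
  unfold FlatDimLE
  exact this

end Dimension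

section Coherent

variable {R}
variable {M P Q : Type u} [AddCommGroup M] [Module R M] [AddCommGroup P] [Module R P]
  [AddCommGroup Q] [Module R Q]

theorem isFinitelyPresented_iff : IsFinitelyPresented R M ↔ Module.FinitePresentation R M := by
  refine ⟨fun ⟨n, f, hf, hfg⟩ => Module.finitePresentation_of_surjective f hf hfg, fun _ => ?_⟩
  obtain ⟨n, f, hf⟩ := Module.Finite.exists_fin' R M
  exact ⟨n, f, hf, Module.FinitePresentation.fg_ker f hf⟩

theorem IsCoherentRing.finitePresentation_of_injective_pi (h : IsCoherentRing R) (n : ℕ) :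
    ∀ (M : Type u) [AddCommGroup M] [Module R M] [Module.Finite R M] (j : M →ₗ[R] Fin n → R),
      Function.Injective j → Module.FinitePresentation R M := by
  induction n with
  | zero =>
    intro M _ _ _ j hj
    have := hj.subsingleton
    infer_instance
  | succ n ih =>
    intro M _ _ _ j hj
    let q : M →ₗ[R] R := LinearMap.proj 0 ∘ₗ j
    have : Module.FinitePresentation R (LinearMap.range q) :=
      isFinitelyPresented_iff.1 (h (LinearMap.range q) (Submodule.FG.of_finite))
    have hq := LinearMap.surjective_rangeRestrict q
    have hfg := Module.FinitePresentation.fg_ker q.rangeRestrict hq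
    have : Module.Finite R (LinearMap.ker q.rangeRestrict) := .of_fg hfg
    have : Module.FinitePresentation R (LinearMap.ker q.rangeRestrict) := by
      refine ih _ (LinearMap.funLeft R R Fin.succ ∘ₗ j ∘ₗ
        (LinearMap.ker q.rangeRestrict).subtype) ?_
      rw [injective_iff_map_eq_zero]
      intro x hx
      have h₀ : q x = 0 := congrArg Subtype.val (LinearMap.mem_ker.1 x.2)
      refine Subtype.ext (hj ?_)
      rw [Submodule.coe_zero, map_zero]
      exact funext (Fin.cases h₀ fun i => congrFun hx i)
    exact Module.finitePresentation_of_ker q.rangeRestrict hq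

theorem IsCoherentRing.finitePresentation_of_injective (h : IsCoherentRing R) [Module.Finite R M]
    [Module.Finite R P] [Module.Projective R P] {j : M →ₗ[R] P} (hj : Function.Injective j) :
    Module.FinitePresentation R M := by
  obtain ⟨n, f, g, -, -, hfg⟩ := Module.Finite.exists_comp_eq_id_of_projective R P
  have hg : Function.Injective g := Function.LeftInverse.injective (DFunLike.congr_fun hfg)
  exact h.finitePresentation_of_injective_pi n M (g ∘ₗ j) (hg.comp hj)

theorem IsCoherentRing.exists_exact (h : IsCoherentRing R) [Module.Finite R M]
    [Module.Finite R P] [Module.Projective R P] (c : M →ₗ[R] P) :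
    ∃ (n : ℕ) (d : (Fin n → R) →ₗ[R] M), Function.Exact d c := by
  have := h.finitePresentation_of_injective (Submodule.injective_subtype (LinearMap.range c))
  have hfg := Module.FinitePresentation.fg_ker _ (LinearMap.surjective_rangeRestrict c)
  rw [LinearMap.ker_rangeRestrict] at hfg
  obtain ⟨n, d, hd⟩ := (Submodule.fg_iff_exists_fin_linearMap R M).1 hfg
  exact ⟨n, d, LinearMap.exact_iff.2 hd.symm⟩

end Coherent

section GorensteinFlat

variable {R}
variable {A X N N' I G : Type u} [AddCommGroup A] [Module R A] [AddCommGroup X] [Module R X]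
  [AddCommGroup N] [Module R N] [AddCommGroup N'] [Module R N'] [AddCommGroup I] [Module R I]
  [AddCommGroup G] [Module R G]

theorem TorOneVanishes.of_equiv (h : TorOneVanishes R N I) (e : N ≃ₗ[R] N') :
    TorOneVanishes R N' I := by
  obtain ⟨K, F, _, _, _, _, k, l, _, hk, hkl, hl⟩ := exists_free_presentation R N
  exact torOneVanishes_of_rTensor_injective (f := k) (g := e.toLinearMap ∘ₗ l)
    (e.injective.comp_exact_iff_exact.2 hkl) (e.surjective.comp hl)
    (h.rTensor_injective hk hkl hl)

theorem exact_subtype_rangeRestrict {B C : Type u} [AddCommGroup B] [Module R B]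
    [AddCommGroup C] [Module R C] {f : A →ₗ[R] B} {g : B →ₗ[R] C}
    (h : LinearMap.range f = LinearMap.ker g) :
    Function.Exact (LinearMap.range f).subtype g.rangeRestrict :=
  LinearMap.exact_iff.2 (by rw [LinearMap.ker_rangeRestrict, Submodule.range_subtype, h])

theorem rTensor_exact_of_torOneVanishes {P₀ P₁ P₂ P₃ : Type u} [AddCommGroup P₀] [Module R P₀]
    [AddCommGroup P₁] [Module R P₁] [AddCommGroup P₂] [Module R P₂] [AddCommGroup P₃]
    [Module R P₃] {a : P₁ →ₗ[R] P₀} {b : P₂ →ₗ[R] P₁} {c : P₃ →ₗ[R] P₂}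
    (hcb : Function.Exact c b) (hba : Function.Exact b a)
    (h : TorOneVanishes R (LinearMap.range a) I) :
    Function.Exact (c.rTensor I) (b.rTensor I) := by
  have hinj := h.rTensor_injective (Submodule.injective_subtype _)
    (exact_subtype_rangeRestrict hba.linearMap_ker_eq.symm) (LinearMap.surjective_rangeRestrict a)
  have hcb' : Function.Exact c b.rangeRestrict :=
    LinearMap.exact_iff.2 (by rw [LinearMap.ker_rangeRestrict, hcb.linearMap_ker_eq])
  have hcomp : b = (LinearMap.range b).subtype ∘ₗ b.rangeRestrict := rfl
  rw [hcomp, LinearMap.rTensor_comp, LinearMap.exact_iff,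
    LinearMap.ker_comp_of_ker_eq_bot _ (LinearMap.ker_eq_bot.2 hinj)]
  exact (rTensor_exact I hcb' (LinearMap.surjective_rangeRestrict b)).linearMap_ker_eq

theorem torOneVanishes_range {F : ℤ → Type u} [∀ i, AddCommGroup (F i)] [∀ i, Module R (F i)]
    {d : ∀ i, F i →ₗ[R] F (i + 1)} (hF : ∀ i, Module.Flat R (F i))
    (hd : ∀ i, LinearMap.range (d i) = LinearMap.ker (d (i + 1)))
    (hI : ∀ i, LinearMap.range ((d i).rTensor I) = LinearMap.ker ((d (i + 1)).rTensor I))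
    (j : ℤ) : TorOneVanishes R (LinearMap.range (d j)) I := by
  obtain ⟨i, rfl⟩ : ∃ i, j = i + 1 + 1 := ⟨j - 2, by ring⟩
  have := hF (i + 1 + 1)
  refine torOneVanishes_of_rTensor_injective (exact_subtype_rangeRestrict (hd (i + 1)))
    (LinearMap.surjective_rangeRestrict _) ?_
  rw [injective_iff_map_eq_zero]
  intro x hx
  obtain ⟨y, rfl⟩ := LinearMap.rTensor_surjective I
    (LinearMap.surjective_rangeRestrict (d (i + 1))) x
  have hy : y ∈ LinearMap.ker ((d (i + 1)).rTensor I) := by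
    rwa [← LinearMap.comp_apply, ← LinearMap.rTensor_comp, LinearMap.subtype_comp_codRestrict]
      at hx
  rw [← hI i] at hy
  obtain ⟨w, rfl⟩ := hy
  have h₀ : (d (i + 1)).rangeRestrict ∘ₗ d i = 0 := by
    refine LinearMap.ext fun x => Subtype.ext ?_
    exact LinearMap.mem_ker.1 (hd i ▸ LinearMap.mem_range_self (d i) x)
  rw [← LinearMap.comp_apply, ← LinearMap.rTensor_comp, h₀, LinearMap.rTensor_zero,
    LinearMap.zero_apply]

theorem IsGorensteinFlat.of_equiv (h : IsGorensteinFlat R N) (e : N' ≃ₗ[R] N) :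
    IsGorensteinFlat R N' := by
  obtain ⟨F, _, _, d, hF, hd, ⟨e'⟩, hI⟩ := h
  exact ⟨F, _, _, d, hF, hd, ⟨e ≪≫ₗ e'⟩, hI⟩

theorem IsGorensteinFlat.torOneVanishes (h : IsGorensteinFlat R G) [Module.Injective R I] :
    TorOneVanishes R G I := by
  obtain ⟨F, _, _, d, hF, hd, ⟨e⟩, hI⟩ := h
  exact (torOneVanishes_range hF hd (hI I _ _ ‹_›) 0).of_equiv e.symm

theorem IsGorensteinFlat.exists_exact (h : IsGorensteinFlat R G) :
    ∃ (H P : Type u) (_ : AddCommGroup H) (_ : Module R H) (_ : AddCommGroup P) (_ : Module R P)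
      (i : H →ₗ[R] P) (p : P →ₗ[R] G), Module.Flat R P ∧ Function.Injective i ∧
      Function.Exact i p ∧ Function.Surjective p ∧
      ∀ (I : Type u) [AddCommGroup I] [Module R I] [Module.Injective R I],
        TorOneVanishes R H I := by
  obtain ⟨F, _, _, d, hF, hd, ⟨e⟩, hI⟩ := h
  refine ⟨LinearMap.range (d (-1)), F 0, _, _, _, _, (LinearMap.range (d (-1))).subtype,
    e.symm.toLinearMap ∘ₗ (d 0).rangeRestrict, hF 0, Submodule.injective_subtype _,
    e.symm.injective.comp_exact_iff_exact.2 (exact_subtype_rangeRestrict (hd (-1))),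
    e.symm.surjective.comp (LinearMap.surjective_rangeRestrict _), fun I _ _ _ =>
      torOneVanishes_range hF hd (hI I _ _ ‹_›) (-1)⟩

theorem flatDimLE_one_of_forall_ideal
    (h : ∀ J : Ideal R, J.FG → ∃ (H P : Type u) (_ : AddCommGroup H) (_ : Module R H)
      (_ : AddCommGroup P) (_ : Module R P) (i : H →ₗ[R] P) (p : P →ₗ[R] R ⧸ J),
      Module.Flat R P ∧ Function.Injective i ∧ Function.Exact i p ∧ Function.Surjective p ∧
      TorOneVanishes R H I) : FlatDimLE R I 1 := by
  obtain ⟨K, F, _, _, _, _, k, l, _, hk, hkl, hl⟩ := exists_free_presentation R I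
  have : Module.Flat R K := flat_of_torOneVanishes fun J hJ => by
    obtain ⟨H, P, _, _, _, _, i, p, _, hi, hip, hp, hH⟩ := h J hJ
    exact hH.shift hi hip hp hk hkl hl
  exact flatDimLE_one_of_exact hk hkl hl

theorem flatDimLE_one_of_isGorensteinFlat_ideal
    (h : ∀ J : Ideal R, J.FG → IsGorensteinFlat R J) [Module.Injective R I] :
    FlatDimLE R I 1 :=
  flatDimLE_one_of_forall_ideal fun J hJ =>
    ⟨J, R, _, _, _, _, J.subtype, J.mkQ, inferInstance, Submodule.injective_subtype J,
      LinearMap.exact_subtype_mkQ J, Submodule.mkQ_surjective J, (h J hJ).torOneVanishes⟩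

theorem GFlatDimLE.exists_exact (h : GFlatDimLE R N 1) :
    ∃ (H P : Type u) (_ : AddCommGroup H) (_ : Module R H) (_ : AddCommGroup P) (_ : Module R P)
      (i : H →ₗ[R] P) (p : P →ₗ[R] N), Module.Flat R P ∧ Function.Injective i ∧
      Function.Exact i p ∧ Function.Surjective p ∧
      ∀ (I : Type u) [AddCommGroup I] [Module R I] [Module.Injective R I],
        TorOneVanishes R H I := by
  unfold GFlatDimLE at h
  obtain ⟨K, G, _, _, _, _, k, l, hK, hG, hk, hkl, hl⟩ :=
    exists_exact_of_resolution (C := @IsGorensteinFlat R _) h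
  obtain ⟨H, P, _, _, _, _, i, p, hP, hi, hip, hp, hH⟩ := hG.exists_exact
  refine ⟨LinearMap.ker (l ∘ₗ p), P, _, _, _, _, (LinearMap.ker (l ∘ₗ p)).subtype, l ∘ₗ p, hP,
    Submodule.injective_subtype _, LinearMap.exact_subtype_ker_map _, hl.comp hp, ?_⟩
  intro I _ _ _
  let i' : H →ₗ[R] LinearMap.ker (l ∘ₗ p) := i.codRestrict _ fun x => by
    simp [hip.apply_apply_eq_zero]
  let p' : LinearMap.ker (l ∘ₗ p) →ₗ[R] LinearMap.range k :=
    (p.comp (Submodule.subtype _)).codRestrict _ fun x => by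
      rw [← hkl.linearMap_ker_eq]
      exact x.2
  refine TorOneVanishes.of_exact (f := i') (g := p') (fun x y hxy => hi (congrArg Subtype.val hxy))
    (fun x => ⟨fun hx => ?_, ?_⟩) (fun y => ?_) (hH I)
    (hK.torOneVanishes.of_equiv (LinearEquiv.ofInjective k hk))
  · obtain ⟨y, hy⟩ := (hip x.1).1 (congrArg Subtype.val hx)
    exact ⟨y, Subtype.ext hy⟩
  · rintro ⟨y, rfl⟩
    exact Subtype.ext (hip.apply_apply_eq_zero y)
  · obtain ⟨x, hx⟩ := hp y.1
    refine ⟨⟨x, ?_⟩, Subtype.ext hx⟩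
    have hy : l y = 0 := (hkl y.1).2 y.2
    simpa [hx] using hy

theorem flatDimLE_one_of_gFlatDimLE_one
    (h : ∀ (M : Type u) (_ : AddCommGroup M) (_ : Module R M), IsFinitelyPresented R M →
      GFlatDimLE R M 1) [Module.Injective R I] : FlatDimLE R I 1 :=
  flatDimLE_one_of_forall_ideal fun J hJ => by
    have : Module.FinitePresentation R (R ⧸ J) :=
      Module.finitePresentation_of_surjective J.mkQ J.mkQ_surjective (by rwa [Submodule.ker_mkQ])
    obtain ⟨H, P, _, _, _, _, i, p, hP, hi, hip, hp, hH⟩ :=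
      (h _ _ _ (isFinitelyPresented_iff.2 this)).exists_exact
    exact ⟨H, P, _, _, _, _, i, p, hP, hi, hip, hp, hH I⟩

theorem isGorensteinFlat_of_injective
    (h : ∀ (F : Type u) (_ : AddCommGroup F) (_ : Module R F), Module.Flat R F →
      ∀ N : Submodule R F, IsGorensteinFlat R N) [Module.Flat R X] {j : N →ₗ[R] X}
    (hj : Function.Injective j) : IsGorensteinFlat R N :=
  (h X _ _ ‹_› (LinearMap.range j)).of_equiv (LinearEquiv.ofInjective j hj)

theorem gFlatDimLE_one_of_forall_submodule
    (h : ∀ (F : Type u) (_ : AddCommGroup F) (_ : Module R F), Module.Flat R F →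
      ∀ N : Submodule R F, IsGorensteinFlat R N) : GFlatDimLE R N 1 := by
  obtain ⟨K, F, _, _, _, _, k, l, _, hk, hkl, hl⟩ := exists_free_presentation R N
  have := exists_resolution_of_exact (C := @IsGorensteinFlat R _)
    (isGorensteinFlat_of_injective h hk)
    (isGorensteinFlat_of_injective h (j := LinearMap.id) Function.injective_id)
    (isGorensteinFlat_of_injective h (j := LinearMap.id) Function.injective_id) hk hkl hl
  unfold GFlatDimLE
  exact this

end GorensteinFlat

section Splicing

variable {R}

theorem exists_int_chain {S : Type*} (r : S → S → Prop) (hl : ∀ z, ∃ y, r y z)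
    (hr : ∀ z, ∃ y, r z y) (z₀ : S) : ∃ z : ℤ → S, z 1 = z₀ ∧ ∀ i, r (z i) (z (i + 1)) := by
  choose a ha using hl
  choose b hb using hr
  let z : ℤ → S
    | .ofNat n => b^[n] z₀
    | .negSucc n => a^[n + 1] z₀
  have hz (i : ℤ) : r (z i) (z (i + 1)) := by
    rcases i with n | _ | n
    · have : z (Int.ofNat n + 1) = b (z (Int.ofNat n)) := Function.iterate_succ_apply' b n z₀
      exact this ▸ hb _
    · exact ha z₀
    · have : z (Int.negSucc (n + 1)) = a (z (Int.negSucc n)) :=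
        Function.iterate_succ_apply' a (n + 1) z₀
      exact this ▸ ha _
  refine ⟨fun i => z (i - 1), rfl, fun i => ?_⟩
  have := hz (i - 1)
  rwa [← add_sub_right_comm] at this

theorem exists_complex_of_class {C E : ∀ (M : Type u) [AddCommGroup M] [Module R M], Prop}
    (hequiv : ∀ (M N : Type u) [AddCommGroup M] [Module R M] [AddCommGroup N] [Module R N],
      (M ≃ₗ[R] N) → C M → C N)
    (hleft : ∀ (N : Type u) [AddCommGroup N] [Module R N], C N →
      ∃ (N' F : Type u) (_ : AddCommGroup N') (_ : Module R N') (_ : AddCommGroup F)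
        (_ : Module R F) (f : N' →ₗ[R] F) (g : F →ₗ[R] N), C N' ∧ E F ∧
        Function.Injective f ∧ Function.Exact f g ∧ Function.Surjective g)
    (hright : ∀ (N : Type u) [AddCommGroup N] [Module R N], C N →
      ∃ (F N' : Type u) (_ : AddCommGroup F) (_ : Module R F) (_ : AddCommGroup N')
        (_ : Module R N') (f : N →ₗ[R] F) (g : F →ₗ[R] N'), C N' ∧ E F ∧
        Function.Injective f ∧ Function.Exact f g ∧ Function.Surjective g)
    {N : Type u} [AddCommGroup N] [Module R N] (hN : C N) :
    ∃ (F : ℤ → Type u) (_ : ∀ i, AddCommGroup (F i)) (_ : ∀ i, Module R (F i))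
      (d : ∀ i, F i →ₗ[R] F (i + 1)), (∀ i, E (F i)) ∧
      (∀ i, LinearMap.range (d i) = LinearMap.ker (d (i + 1))) ∧
      Nonempty (N ≃ₗ[R] LinearMap.range (d 0)) ∧ ∀ i, C (LinearMap.range (d i)) := by
  let r (y z : {M : ModuleCat.{u} R // C M}) : Prop :=
    ∃ (F : Type u) (_ : AddCommGroup F) (_ : Module R F) (f : y.1 →ₗ[R] F) (g : F →ₗ[R] z.1),
      E F ∧ Function.Injective f ∧ Function.Exact f g ∧ Function.Surjective g
  obtain ⟨z, hz₀, hz⟩ := exists_int_chain r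
    (fun ⟨z, hz⟩ => by
      obtain ⟨N', F, _, _, _, _, f, g, hN', h⟩ := hleft z hz
      exact ⟨⟨ModuleCat.of R N', hN'⟩, F, _, _, f, g, h⟩)
    (fun ⟨z, hz⟩ => by
      obtain ⟨F, N', _, _, _, _, f, g, hN', h⟩ := hright z hz
      exact ⟨⟨ModuleCat.of R N', hN'⟩, F, _, _, f, g, h⟩) ⟨ModuleCat.of R N, hN⟩
  choose F _ _ f g hF hf hfg hg using hz
  have hrange (i : ℤ) : LinearMap.range (f (i + 1) ∘ₗ g i) = LinearMap.range (f (i + 1)) :=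
    LinearMap.range_comp_of_range_eq_top _ (LinearMap.range_eq_top.2 (hg i))
  have e (i : ℤ) : (z (i + 1)).1 ≃ₗ[R] LinearMap.range (f (i + 1) ∘ₗ g i) :=
    LinearEquiv.ofInjective (f (i + 1)) (hf (i + 1)) ≪≫ₗ LinearEquiv.ofEq _ _ (hrange i).symm
  refine ⟨F, inferInstance, inferInstance, fun i => f (i + 1) ∘ₗ g i, hF, fun i => ?_, ?_,
    fun i => hequiv _ _ (e i) (z (i + 1)).2⟩
  · rw [hrange, LinearMap.ker_comp_of_ker_eq_bot _ (LinearMap.ker_eq_bot.2 (hf _)),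
      (hfg (i + 1)).linearMap_ker_eq]
  · have : Nonempty (N ≃ₗ[R] (z (0 + 1)).1) := by
      rw [zero_add, hz₀]
      exact ⟨LinearEquiv.refl R N⟩
    exact this.map fun e' => e' ≪≫ₗ e 0

end Splicing

section EmbedsInFlat

variable {R}

variable (R) in
/-- A module embeds in a flat module. -/
def EmbedsInFlat (N : Type u) [AddCommGroup N] [Module R N] : Prop :=
  ∃ (X : Type u) (_ : AddCommGroup X) (_ : Module R X) (j : N →ₗ[R] X),
    Module.Flat R X ∧ Function.Injective j

variable (R) in
theorem exists_injective_embedding (M : Type u) [AddCommGroup M] [Module R M] :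
    ∃ (E : Type u) (_ : AddCommGroup E) (_ : Module R E) (e : M →ₗ[R] E),
      Module.Injective R E ∧ Function.Injective e := by
  obtain ⟨⟨E, hE, e, he⟩⟩ :=
    CategoryTheory.EnoughInjectives.presentation (ModuleCat.of R M)
  exact ⟨E, _, _, e.hom, Module.injective_module_of_injective_object R E,
    (ModuleCat.mono_iff_injective _).1 he⟩

theorem FlatDimLE.exists_exact {E : Type u} [AddCommGroup E] [Module R E]
    (h : FlatDimLE R E 1) :
    ∃ (K F : Type u) (_ : AddCommGroup K) (_ : Module R K) (_ : AddCommGroup F) (_ : Module R F)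
      (k : K →ₗ[R] F) (l : F →ₗ[R] E), Module.Flat R K ∧ Module.Flat R F ∧
      Function.Injective k ∧ Function.Exact k l ∧ Function.Surjective l := by
  unfold FlatDimLE at h
  exact exists_exact_of_resolution (C := fun M [AddCommGroup M] [Module R M] => Module.Flat R M)
    h

variable (h : ∀ (I : Type u) (_ : AddCommGroup I) (_ : Module R I), Module.Injective R I →
  FlatDimLE R I 1)
include h

theorem EmbedsInFlat.torOneVanishes {N I : Type u} [AddCommGroup N] [Module R N]
    [AddCommGroup I] [Module R I] [Module.Injective R I] (hN : EmbedsInFlat R N) :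
    TorOneVanishes R N I := by
  obtain ⟨X, _, _, j, _, hj⟩ := hN
  obtain ⟨K, F, _, _, _, _, k, l, _, _, hk, hkl, hl⟩ := (h I _ _ ‹_›).exists_exact
  exact torOneVanishes_of_injective_of_flat hk hkl hl hj

theorem EmbedsInFlat.exists_exact {N : Type u} [AddCommGroup N] [Module R N]
    (hN : EmbedsInFlat R N) :
    ∃ (Y N' : Type u) (_ : AddCommGroup Y) (_ : Module R Y) (_ : AddCommGroup N')
      (_ : Module R N') (f : N →ₗ[R] Y) (g : Y →ₗ[R] N'), EmbedsInFlat R N' ∧ Module.Flat R Y ∧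
      Function.Injective f ∧ Function.Exact f g ∧ Function.Surjective g := by
  obtain ⟨X, _, _, j, _, hj⟩ := hN
  obtain ⟨E, _, _, e, hE, he⟩ := exists_injective_embedding R (X ⧸ LinearMap.range j)
  obtain ⟨K, F, _, _, _, _, k, l, _, _, hk, hkl, hl⟩ := (h E _ _ hE).exists_exact
  let q : X →ₗ[R] E := e ∘ₗ (LinearMap.range j).mkQ
  have hq (x : X) : q x = 0 ↔ x ∈ LinearMap.range j := by
    rw [← Submodule.Quotient.mk_eq_zero, ← map_eq_zero_iff e he]
    rfl
  let Y : Submodule R (X × F) :=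
    LinearMap.ker (q ∘ₗ LinearMap.fst R X F - l ∘ₗ LinearMap.snd R X F)
  have hY (y : X × F) : y ∈ Y ↔ q y.1 = l y.2 := by simp [Y, sub_eq_zero]
  have hflat : Module.Flat R Y := by
    refine flat_of_exact (f := (LinearMap.inr R X F ∘ₗ k).codRestrict Y fun t => ?_)
      (g := LinearMap.fst R X F ∘ₗ Y.subtype) (fun s t hst => ?_) (fun y => ⟨fun hy => ?_, ?_⟩)
      (fun x => ?_)
    · simp [hY, hkl.apply_apply_eq_zero]
    · exact hk (congrArg Prod.snd (congrArg Subtype.val hst))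
    · have hy₁ : y.1.1 = 0 := hy
      have := (hY y).1 y.2
      rw [hy₁, map_zero] at this
      obtain ⟨t, ht⟩ := (hkl y.1.2).1 this.symm
      exact ⟨t, Subtype.ext (Prod.ext hy₁.symm ht)⟩
    · rintro ⟨t, rfl⟩
      rfl
    · obtain ⟨y, hy⟩ := hl (q x)
      exact ⟨⟨(x, y), (hY _).2 hy.symm⟩, rfl⟩
  let s : Y →ₗ[R] F := LinearMap.snd R X F ∘ₗ Y.subtype
  refine ⟨Y, LinearMap.range s, _, _, _, _, (LinearMap.inl R X F ∘ₗ j).codRestrict Y fun n => ?_,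
    s.rangeRestrict, ⟨F, _, _, Submodule.subtype _, ‹_›, Submodule.injective_subtype _⟩, hflat,
    fun m n hmn => ?_, fun y => ⟨fun hy => ?_, ?_⟩, LinearMap.surjective_rangeRestrict s⟩
  · simpa [hY] using (hq (j n)).2 ⟨n, rfl⟩
  · exact hj (congrArg Prod.fst (congrArg Subtype.val hmn))
  · have hy₂ : y.1.2 = 0 := congrArg Subtype.val hy
    have := (hY y).1 y.2
    rw [hy₂, map_zero, hq] at this
    obtain ⟨n, hn⟩ := this
    exact ⟨n, Subtype.ext (Prod.ext hn hy₂.symm)⟩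
  · rintro ⟨n, rfl⟩
    rfl

theorem EmbedsInFlat.isGorensteinFlat {N : Type u} [AddCommGroup N] [Module R N]
    (hN : EmbedsInFlat R N) : IsGorensteinFlat R N := by
  obtain ⟨F, _, _, d, hF, hd, he, hC⟩ :=
    exists_complex_of_class (C := @EmbedsInFlat R _)
      (E := fun M [AddCommGroup M] [Module R M] => Module.Flat R M)
      (fun M N _ _ _ _ e ⟨X, _, _, j, hX, hj⟩ =>
        ⟨X, _, _, j ∘ₗ e.symm.toLinearMap, hX, hj.comp e.symm.injective⟩)
      (fun N _ _ _ => by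
        obtain ⟨K, F, _, _, _, _, k, l, _, hk, hkl, hl⟩ := exists_free_presentation R N
        exact ⟨K, F, _, _, _, _, k, l, ⟨F, _, _, k, inferInstance, hk⟩, inferInstance, hk, hkl,
          hl⟩)
      (fun N _ _ hN => hN.exists_exact h) hN
  refine ⟨F, _, _, d, hF, hd, he, fun I _ _ _ i => ?_⟩
  exact (rTensor_exact_of_torOneVanishes (LinearMap.exact_iff.2 (hd i).symm)
    (LinearMap.exact_iff.2 (hd (i + 1)).symm)
    ((hC (i + 1 + 1)).torOneVanishes h)).linearMap_ker_eq.symm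

end EmbedsInFlat

section DualExact

open TensorProduct

variable {R}

theorem exists_comp_eq_of_surjective {A B C : Type u} [AddCommGroup A] [Module R A]
    [AddCommGroup B] [Module R B] [AddCommGroup C] [Module R C] {π : A →ₗ[R] B}
    (hπ : Function.Surjective π) (w : A →ₗ[R] C) (hw : LinearMap.ker π ≤ LinearMap.ker w) :
    ∃ f : B →ₗ[R] C, f ∘ₗ π = w := by
  refine ⟨(LinearMap.ker π).liftQ w hw ∘ₗ
    (π.quotKerEquivOfSurjective hπ).symm.toLinearMap, LinearMap.ext fun x => ?_⟩
  have : (π.quotKerEquivOfSurjective hπ).symm (π x) = Submodule.Quotient.mk x :=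
    (LinearEquiv.symm_apply_eq _).2 rfl
  simp [this]

theorem exists_comp_rangeRestrict_eq {A B C : Type u} [AddCommGroup A] [Module R A]
    [AddCommGroup B] [Module R B] [AddCommGroup C] [Module R C] (c : A →ₗ[R] B) (w : A →ₗ[R] C)
    (hw : LinearMap.ker c ≤ LinearMap.ker w) :
    ∃ f : LinearMap.range c →ₗ[R] C, f ∘ₗ c.rangeRestrict = w :=
  exists_comp_eq_of_surjective (LinearMap.surjective_rangeRestrict c) w
    (by rwa [LinearMap.ker_rangeRestrict])

variable (R) in
/-- Taking duals turns exact sequences of finite free modules of length two into exact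
sequences at the second spot. -/
def DualExact : Prop :=
  ∀ (P₀ P₁ P₂ P₃ : Type u) [AddCommGroup P₀] [Module R P₀] [AddCommGroup P₁] [Module R P₁]
    [AddCommGroup P₂] [Module R P₂] [AddCommGroup P₃] [Module R P₃]
    [Module.Finite R P₀] [Module.Free R P₀] [Module.Finite R P₁] [Module.Free R P₁]
    [Module.Finite R P₂] [Module.Free R P₂] [Module.Finite R P₃] [Module.Free R P₃]
    (a : P₁ →ₗ[R] P₀) (b : P₂ →ₗ[R] P₁) (c : P₃ →ₗ[R] P₂), Function.Exact c b →
    Function.Exact b a → Function.Exact b.dualMap c.dualMap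

variable {P Q E : Type u} [AddCommGroup P] [Module R P] [AddCommGroup Q] [Module R Q]
  [AddCommGroup E] [Module R E]

/-- For `P` finite free, `P ⊗ E` is the module of linear maps from the dual of `P` to `E`. -/
def tensorEquivDualHom (P E : Type u) [AddCommGroup P] [Module R P] [AddCommGroup E] [Module R E]
    [Module.Finite R P] [Module.Free R P] : P ⊗[R] E ≃ₗ[R] (Module.Dual R P →ₗ[R] E) :=
  (LinearEquiv.rTensor E (Module.evalEquiv R P)).trans
    (dualTensorHomEquiv R (Module.Dual R P) E)

theorem tensorEquivDualHom_rTensor [Module.Finite R P] [Module.Free R P] [Module.Finite R Q]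
    [Module.Free R Q] (b : P →ₗ[R] Q) (z : P ⊗[R] E) :
    tensorEquivDualHom Q E (b.rTensor E z) = tensorEquivDualHom P E z ∘ₗ b.dualMap := by
  induction z with
  | zero => simp
  | add x y hx hy => simp only [map_add, hx, hy, LinearMap.add_comp]
  | tmul p e => rfl

theorem dualExact_of_flatDimLE_one
    (h : ∀ (I : Type u) (_ : AddCommGroup I) (_ : Module R I), Module.Injective R I →
      FlatDimLE R I 1) : DualExact R := by
  intro P₀ P₁ P₂ P₃ _ _ _ _ _ _ _ _ _ _ _ _ _ _ _ _ a b c hcb hba f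
  refine ⟨fun hf => ?_, ?_⟩
  · obtain ⟨E, _, _, e, _, he⟩ :=
      exists_injective_embedding R (Module.Dual R P₂ ⧸ LinearMap.range b.dualMap)
    let φ : Module.Dual R P₂ →ₗ[R] E := e ∘ₗ (LinearMap.range b.dualMap).mkQ
    have hφ : φ ∘ₗ b.dualMap = 0 := by
      rw [LinearMap.comp_assoc, LinearMap.range_mkQ_comp, LinearMap.comp_zero]
    have htor : TorOneVanishes R (LinearMap.range a) E :=
      EmbedsInFlat.torOneVanishes h ⟨P₀, _, _, Submodule.subtype _, inferInstance,
        Submodule.injective_subtype _⟩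
    have hz : b.rTensor E ((tensorEquivDualHom P₂ E).symm φ) = 0 := by
      apply (tensorEquivDualHom P₁ E).injective
      rw [tensorEquivDualHom_rTensor, LinearEquiv.apply_symm_apply, hφ, map_zero]
    obtain ⟨w, hw⟩ := (rTensor_exact_of_torOneVanishes hcb hba htor _).1 hz
    have hφc : φ = tensorEquivDualHom P₃ E w ∘ₗ c.dualMap := by
      rw [← tensorEquivDualHom_rTensor, hw, LinearEquiv.apply_symm_apply]
    have hφf : e ((LinearMap.range b.dualMap).mkQ f) = 0 := by
      change φ f = 0
      rw [hφc, LinearMap.comp_apply, hf, map_zero]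
    rw [map_eq_zero_iff e he] at hφf
    exact (Submodule.Quotient.mk_eq_zero _).1 hφf
  · rintro ⟨g, rfl⟩
    exact LinearMap.ext fun x => by simp [hcb.apply_apply_eq_zero]

theorem DualExact.flatDimLE_one_of_fpInjective (h : DualExact R) (hcoh : IsCoherentRing R)
    (hE : ∀ (P : Type u) (_ : AddCommGroup P) (_ : Module R P), IsFinitelyPresented R P →
      ExtVanishes R P E 1) : FlatDimLE R E 1 := by
  refine flatDimLE_one_of_forall_ideal fun J hJ =>
    ⟨J, R, _, _, _, _, J.subtype, J.mkQ, inferInstance, Submodule.injective_subtype J,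
      LinearMap.exact_subtype_mkQ J, Submodule.mkQ_surjective J, ?_⟩
  have : Module.Finite R J := .of_fg hJ
  obtain ⟨m, π, hπ⟩ := Module.Finite.exists_fin' R J
  obtain ⟨q, b, hb⟩ := hcoh.exists_exact (J.subtype ∘ₗ π)
  obtain ⟨r, c, hc⟩ := hcoh.exists_exact b
  have hbπ : Function.Exact b π := (Submodule.injective_subtype J).comp_exact_iff_exact.1 hb
  refine torOneVanishes_of_rTensor_injective (f := (LinearMap.range b).subtype) (g := π)
    (LinearMap.exact_iff.2 (by rw [Submodule.range_subtype, hbπ.linearMap_ker_eq])) hπ ?_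
  rw [injective_iff_map_eq_zero]
  intro x hx
  obtain ⟨z, rfl⟩ := LinearMap.rTensor_surjective E (LinearMap.surjective_rangeRestrict b) x
  rw [← LinearMap.comp_apply, ← LinearMap.rTensor_comp] at hx
  change b.rTensor E z = 0 at hx
  have hker : LinearMap.ker c.dualMap ≤ LinearMap.ker (tensorEquivDualHom _ E z) := by
    intro f hf
    obtain ⟨g, rfl⟩ := (h _ _ _ _ _ b c hc hb f).1 hf
    have := tensorEquivDualHom_rTensor b z
    rw [hx, map_zero] at this
    exact LinearMap.congr_fun this.symm g
  obtain ⟨φ, hφ⟩ := exists_comp_rangeRestrict_eq c.dualMap _ hker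
  have hfp : Module.FinitePresentation R
      (Module.Dual R (Fin r → R) ⧸ LinearMap.range c.dualMap) := by
    have := Module.finitePresentation_of_projective R (Module.Dual R (Fin r → R))
    exact Module.finitePresentation_of_surjective (Submodule.mkQ _) (Submodule.mkQ_surjective _)
      (by rw [Submodule.ker_mkQ]; exact .of_finite)
  obtain ⟨ψ, hψ⟩ := exists_extension_of_ext_one
    (Submodule.injective_subtype (LinearMap.range c.dualMap)) (Submodule.mkQ_surjective _)
    (LinearMap.exact_subtype_mkQ _) E ((extVanishes_succ_iff _ _ 0).1
      (hE _ _ _ (isFinitelyPresented_iff.2 hfp))) φ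
  have hz : c.rTensor E ((tensorEquivDualHom _ E).symm ψ) = z := by
    apply (tensorEquivDualHom _ E).injective
    rw [tensorEquivDualHom_rTensor, LinearEquiv.apply_symm_apply, ← hφ, ← hψ]
    rfl
  have hzero : b.rangeRestrict ∘ₗ c = 0 :=
    LinearMap.ext fun x => Subtype.ext (hc.apply_apply_eq_zero x)
  rw [← hz, ← LinearMap.comp_apply, ← LinearMap.rTensor_comp, hzero, LinearMap.rTensor_zero,
    LinearMap.zero_apply]

end DualExact

section ExtOverCoherent

open CategoryTheory

variable {R}
variable {N F G : Type u} [AddCommGroup N] [Module R N] [AddCommGroup F] [Module R F]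
  [AddCommGroup G] [Module R G]

theorem DualExact.exists_extension {P₀ P₁ P₂ P₃ : Type u} [AddCommGroup P₀] [Module R P₀]
    [AddCommGroup P₁] [Module R P₁] [AddCommGroup P₂] [Module R P₂] [AddCommGroup P₃]
    [Module R P₃] [Module.Finite R P₀] [Module.Free R P₀] [Module.Finite R P₁] [Module.Free R P₁]
    [Module.Finite R P₂] [Module.Free R P₂] [Module.Finite R P₃] [Module.Free R P₃]
    (h : DualExact R) {a : P₁ →ₗ[R] P₀} {b : P₂ →ₗ[R] P₁} {c : P₃ →ₗ[R] P₂}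
    (hcb : Function.Exact c b) (hba : Function.Exact b a) [Module.Flat R F]
    (φ : LinearMap.range b →ₗ[R] F) :
    ∃ ψ : P₁ →ₗ[R] F, ψ ∘ₗ (LinearMap.range b).subtype = φ := by
  have := Module.finitePresentation_of_projective R P₂
  have : Module.FinitePresentation R (LinearMap.range b) := by
    refine Module.finitePresentation_of_surjective b.rangeRestrict
      (LinearMap.surjective_rangeRestrict b) ?_
    rw [LinearMap.ker_rangeRestrict, hcb.linearMap_ker_eq]
    exact .of_finite
  obtain ⟨k, s, t, rfl⟩ := Module.Flat.exists_factorization_of_finitePresentation φ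
  have hs (i : Fin k) : ∃ g : P₁ →ₗ[R] R, ∀ x, g (b x) = s (b.rangeRestrict x) i := by
    let f : Module.Dual R P₂ := Finsupp.lapply i ∘ₗ s ∘ₗ b.rangeRestrict
    have hf : c.dualMap f = 0 := LinearMap.ext fun x => by
      have : b.rangeRestrict (c x) = 0 := Subtype.ext (hcb.apply_apply_eq_zero x)
      simp [f, this]
    obtain ⟨g, hg⟩ := (h _ _ _ _ a b c hcb hba f).1 hf
    exact ⟨g, LinearMap.congr_fun hg⟩
  choose g hg using hs
  refine ⟨t ∘ₗ (Finsupp.linearEquivFunOnFinite R R (Fin k)).symm.toLinearMap ∘ₗ LinearMap.pi g,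
    LinearMap.ext ?_⟩
  rintro ⟨_, x, rfl⟩
  refine congrArg t (Finsupp.ext fun i => ?_)
  exact hg i x

theorem DualExact.subsingleton_ext_one (h : DualExact R) (hcoh : IsCoherentRing R)
    {P : Type u} [AddCommGroup P] [Module R P] [Module.Finite R P] [Module.Free R P]
    [Module.Finite R N] {j : N →ₗ[R] P} (hj : Function.Injective j) [Module.Flat R F] :
    Subsingleton (Abelian.Ext (ModuleCat.of R N) (ModuleCat.of R F) 1) := by
  obtain ⟨m, π, hπ⟩ := Module.Finite.exists_fin' R N
  obtain ⟨q, b, hb⟩ := hcoh.exists_exact (j ∘ₗ π)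
  obtain ⟨r, c, hc⟩ := hcoh.exists_exact b
  have hbπ : Function.Exact b π := hj.comp_exact_iff_exact.1 hb
  exact subsingleton_ext_one_of_exists_extension (Submodule.injective_subtype (LinearMap.range b))
    hπ (LinearMap.exact_iff.2 (by rw [Submodule.range_subtype, hbπ.linearMap_ker_eq])) F
    (subsingleton_ext_of_projective _ _ 0) fun φ => h.exists_extension hc hb φ

theorem DualExact.extVanishes_two (h : DualExact R) (hcoh : IsCoherentRing R)
    (hN : IsFinitelyPresented R N) [Module.Flat R F] : ExtVanishes R N F 2 := by
  obtain ⟨n, l, hl, hfg⟩ := hN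
  have : Module.Finite R (LinearMap.ker l) := .of_fg hfg
  rw [extVanishes_succ_iff]
  exact subsingleton_ext_right (Submodule.injective_subtype _) hl
    (LinearMap.exact_subtype_ker_map l) F 1
    (h.subsingleton_ext_one hcoh (Submodule.injective_subtype (LinearMap.ker l)))
    (subsingleton_ext_of_projective _ _ 1)

theorem dualExact_of_subsingleton_ext_two
    (h : ∀ (M : Type u) [AddCommGroup M] [Module R M], Module.FinitePresentation R M →
      Subsingleton (Abelian.Ext (ModuleCat.of R M) (ModuleCat.of R R) 2)) : DualExact R := by
  intro P₀ P₁ P₂ P₃ _ _ _ _ _ _ _ _ _ _ _ _ _ _ _ _ a b c hcb hba f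
  refine ⟨fun hf => ?_, ?_⟩
  · have := Module.finitePresentation_of_projective R P₀
    have h₂ := h (P₀ ⧸ LinearMap.range a) (Module.finitePresentation_of_surjective
      (Submodule.mkQ _) (Submodule.mkQ_surjective _)
      (by rw [Submodule.ker_mkQ]; exact .of_finite))
    have h₁ := subsingleton_ext_left (Submodule.injective_subtype (LinearMap.range a))
      (Submodule.mkQ_surjective _) (LinearMap.exact_subtype_mkQ _) R 1
      (subsingleton_ext_of_projective _ _ 0) h₂
    have hker : LinearMap.ker b ≤ LinearMap.ker f := by
      rw [hcb.linearMap_ker_eq]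
      rintro _ ⟨x, rfl⟩
      exact LinearMap.congr_fun hf x
    obtain ⟨φ, hφ⟩ := exists_comp_rangeRestrict_eq b f hker
    obtain ⟨ψ, hψ⟩ := exists_extension_of_ext_one
      (Submodule.injective_subtype _) (LinearMap.surjective_rangeRestrict a)
      (exact_subtype_rangeRestrict hba.linearMap_ker_eq.symm) R h₁ φ
    refine ⟨ψ, ?_⟩
    rw [← hφ, ← hψ]
    rfl
  · rintro ⟨g, rfl⟩
    exact LinearMap.ext fun x => by simp [hcb.apply_apply_eq_zero]

end ExtOverCoherent

section GorensteinProjective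

open CategoryTheory

variable {R}

theorem subsingleton_ext_of_equiv_range {F : ℤ → Type u} [∀ i, AddCommGroup (F i)]
    [∀ i, Module R (F i)] {d : ∀ i, F i →ₗ[R] F (i + 1)} (hF : ∀ i, Module.Projective R (F i))
    (hd : ∀ i, LinearMap.range (d i) = LinearMap.ker (d (i + 1)))
    {Q : Type u} [AddCommGroup Q] [Module R Q]
    (hQ : ∀ (i : ℤ) (g : F (i + 1) →ₗ[R] Q), g.comp (d i) = 0 →
      ∃ h : F (i + 1 + 1) →ₗ[R] Q, h.comp (d (i + 1)) = g) (n : ℕ) :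
    ∀ (j : ℤ) (G : Type u) [AddCommGroup G] [Module R G] (_ : G ≃ₗ[R] LinearMap.range (d j)),
      Subsingleton (Abelian.Ext (ModuleCat.of R G) (ModuleCat.of R Q) (n + 1)) := by
  have hexact (i : ℤ) (G : Type u) [AddCommGroup G] [Module R G]
      (e : G ≃ₗ[R] LinearMap.range (d (i + 1))) :
      Function.Exact (LinearMap.range (d i)).subtype
        (e.symm.toLinearMap ∘ₗ (d (i + 1)).rangeRestrict) :=
    e.symm.injective.comp_exact_iff_exact.2 (exact_subtype_rangeRestrict (hd i))
  have hsurj (i : ℤ) (G : Type u) [AddCommGroup G] [Module R G]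
      (e : G ≃ₗ[R] LinearMap.range (d (i + 1))) :
      Function.Surjective (e.symm.toLinearMap ∘ₗ (d (i + 1)).rangeRestrict) :=
    e.symm.surjective.comp (LinearMap.surjective_rangeRestrict _)
  induction n with
  | zero =>
    intro j G _ _ e
    obtain ⟨i, rfl⟩ : ∃ i, j = i + 1 + 1 := ⟨j - 2, by ring⟩
    have := hF (i + 1 + 1)
    refine subsingleton_ext_one_of_exists_extension (Submodule.injective_subtype _)
      (hsurj (i + 1) G e) (hexact (i + 1) G e) Q (subsingleton_ext_of_projective _ _ 0) fun φ => ?_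
    have hφ : (φ ∘ₗ (d (i + 1)).rangeRestrict) ∘ₗ d i = 0 := LinearMap.ext fun x => by
      have : (d (i + 1)).rangeRestrict (d i x) = 0 :=
        Subtype.ext (LinearMap.mem_ker.1 (hd i ▸ LinearMap.mem_range_self (d i) x))
      simp [this]
    obtain ⟨ψ, hψ⟩ := hQ i _ hφ
    refine ⟨ψ, LinearMap.ext ?_⟩
    rintro ⟨_, x, rfl⟩
    exact LinearMap.congr_fun hψ x
  | succ n ih =>
    intro j G _ _ e
    obtain ⟨i, rfl⟩ : ∃ i, j = i + 1 := ⟨j - 1, by ring⟩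
    have := hF (i + 1)
    exact subsingleton_ext_right (Submodule.injective_subtype _) (hsurj i G e) (hexact i G e) Q
      (n + 1) (ih i _ (LinearEquiv.refl R _)) (subsingleton_ext_of_projective _ _ (n + 1))

theorem IsGorensteinProjective.subsingleton_ext {G Q : Type u} [AddCommGroup G] [Module R G]
    [AddCommGroup Q] [Module R Q] [Module.Projective R Q] (h : IsGorensteinProjective R G)
    (n : ℕ) : Subsingleton (Abelian.Ext (ModuleCat.of R G) (ModuleCat.of R Q) (n + 1)) := by
  obtain ⟨F, _, _, d, hF, hd, ⟨e⟩, hQ⟩ := h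
  exact subsingleton_ext_of_equiv_range hF hd (hQ Q _ _ ‹_›) n 0 G e

theorem GProjDimLE.subsingleton_ext_two {M Q : Type u} [AddCommGroup M] [Module R M]
    [AddCommGroup Q] [Module R Q] [Module.Projective R Q] (h : GProjDimLE R M 1) :
    Subsingleton (Abelian.Ext (ModuleCat.of R M) (ModuleCat.of R Q) 2) := by
  unfold GProjDimLE at h
  obtain ⟨K, G, _, _, _, _, k, l, hK, hG, hk, hkl, hl⟩ :=
    exists_exact_of_resolution (C := @IsGorensteinProjective R _) h
  exact subsingleton_ext_right hk hl hkl Q 1 (hK.subsingleton_ext 0) (hG.subsingleton_ext 1)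

variable (R) in
/-- A finitely generated module that embeds in a finite free module. -/
def FiniteEmbedsInFree (N : Type u) [AddCommGroup N] [Module R N] : Prop :=
  Module.Finite R N ∧ ∃ (P : Type u) (_ : AddCommGroup P) (_ : Module R P) (j : N →ₗ[R] P),
    Module.Finite R P ∧ Module.Free R P ∧ Function.Injective j

variable {N : Type u} [AddCommGroup N] [Module R N]

theorem FiniteEmbedsInFree.exists_exact_left (hcoh : IsCoherentRing R)
    (hN : FiniteEmbedsInFree R N) :
    ∃ (K F : Type u) (_ : AddCommGroup K) (_ : Module R K) (_ : AddCommGroup F)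
      (_ : Module R F) (k : K →ₗ[R] F) (l : F →ₗ[R] N), FiniteEmbedsInFree R K ∧
      Module.Projective R F ∧ Function.Injective k ∧ Function.Exact k l ∧
      Function.Surjective l := by
  obtain ⟨_, P, _, _, j, _, _, hj⟩ := hN
  have := hcoh.finitePresentation_of_injective hj
  obtain ⟨n, l, hl⟩ := Module.Finite.exists_fin' R N
  exact ⟨LinearMap.ker l, Fin n → R, _, _, _, _, (LinearMap.ker l).subtype, l,
    ⟨.of_fg (Module.FinitePresentation.fg_ker l hl), Fin n → R, _, _, Submodule.subtype _,
      inferInstance, inferInstance, Submodule.injective_subtype _⟩, inferInstance,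
    Submodule.injective_subtype _, LinearMap.exact_subtype_ker_map l, hl⟩

theorem FiniteEmbedsInFree.exists_exact_right (h : DualExact R) (hcoh : IsCoherentRing R)
    (hN : FiniteEmbedsInFree R N) :
    ∃ (F N' : Type u) (_ : AddCommGroup F) (_ : Module R F) (_ : AddCommGroup N')
      (_ : Module R N') (f : N →ₗ[R] F) (g : F →ₗ[R] N'), FiniteEmbedsInFree R N' ∧
      Module.Projective R F ∧ Function.Injective f ∧ Function.Exact f g ∧
      Function.Surjective g := by
  obtain ⟨_, P, _, _, j, _, _, hj⟩ := hN
  obtain ⟨m, π, hπ⟩ := Module.Finite.exists_fin' R N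
  obtain ⟨q, b, hb⟩ := hcoh.exists_exact (j ∘ₗ π)
  have hbπ : Function.Exact b π := hj.comp_exact_iff_exact.1 hb
  obtain ⟨s, u, hu⟩ := hcoh.exists_exact b.dualMap
  obtain ⟨t, v, hv⟩ := hcoh.exists_exact u
  let w : (Fin m → R) →ₗ[R] Module.Dual R (Fin s → R) :=
    u.dualMap ∘ₗ Module.Dual.eval R (Fin m → R)
  have hker : LinearMap.ker w = LinearMap.ker π := by
    ext x
    rw [hbπ.linearMap_ker_eq]
    refine ⟨fun hx => ?_, ?_⟩
    · rw [← hb.linearMap_ker_eq, LinearMap.mem_ker, ← Module.forall_dual_apply_eq_zero_iff R]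
      intro f
      have hf : b.dualMap (f ∘ₗ j ∘ₗ π) = 0 := LinearMap.ext fun y => by
        have := hb.apply_apply_eq_zero y
        exact (congrArg f this).trans (map_zero f)
      obtain ⟨y, hy⟩ := (hu _).1 hf
      have := LinearMap.congr_fun (LinearMap.mem_ker.1 hx) y
      exact (LinearMap.congr_fun hy x).symm.trans this
    · rintro ⟨y, rfl⟩
      exact LinearMap.ext fun z => LinearMap.congr_fun (hu.apply_apply_eq_zero z) y
  have hrange : LinearMap.range w = LinearMap.ker v.dualMap := by
    rw [LinearMap.range_comp_of_range_eq_top, (h _ _ _ _ _ u v hv hu).linearMap_ker_eq]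
    exact LinearMap.range_eq_top.2 (Module.bijective_dual_eval R _).2
  obtain ⟨f, hf⟩ := exists_comp_eq_of_surjective hπ w hker.ge
  refine ⟨Module.Dual R (Fin s → R), LinearMap.range v.dualMap, inferInstance,
    inferInstance, inferInstance, inferInstance, f, v.dualMap.rangeRestrict, ⟨inferInstance,
      Module.Dual R (Fin t → R), _, _, Submodule.subtype _, inferInstance, inferInstance,
      Submodule.injective_subtype _⟩,
    inferInstance, ?_, ?_, v.dualMap.surjective_rangeRestrict⟩
  · rw [injective_iff_map_eq_zero]
    intro n hn
    obtain ⟨x, rfl⟩ := hπ n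
    rw [← LinearMap.comp_apply, hf, ← LinearMap.mem_ker, hker] at hn
    exact hn
  · rw [LinearMap.exact_iff, LinearMap.ker_rangeRestrict, ← hrange, ← hf,
      LinearMap.range_comp_of_range_eq_top f (LinearMap.range_eq_top.2 hπ)]

theorem FiniteEmbedsInFree.isGorensteinProjective (h : DualExact R) (hcoh : IsCoherentRing R)
    (hN : FiniteEmbedsInFree R N) : IsGorensteinProjective R N := by
  obtain ⟨F, _, _, d, hF, hd, he, hC⟩ :=
    exists_complex_of_class (C := @FiniteEmbedsInFree R _)
      (E := fun M [AddCommGroup M] [Module R M] => Module.Projective R M)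
      (fun M N _ _ _ _ e ⟨_, X, _, _, j, hX, hX', hj⟩ =>
        ⟨Module.Finite.equiv e, X, _, _, j ∘ₗ e.symm.toLinearMap, hX, hX',
          hj.comp e.symm.injective⟩)
      (fun N _ _ hN => hN.exists_exact_left hcoh)
      (fun N _ _ hN => hN.exists_exact_right h hcoh) hN
  refine ⟨F, _, _, d, hF, hd, he, fun Q _ _ _ i g hg => ?_⟩
  obtain ⟨_, P, _, _, j, _, _, hj⟩ := hC (i + 1 + 1)
  obtain ⟨φ, hφ⟩ := exists_comp_rangeRestrict_eq (d (i + 1)) g <| by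
    rw [← hd]
    rintro _ ⟨x, rfl⟩
    exact LinearMap.congr_fun hg x
  obtain ⟨ψ, hψ⟩ := exists_extension_of_ext_one (Submodule.injective_subtype _)
    (LinearMap.surjective_rangeRestrict _) (exact_subtype_rangeRestrict (hd (i + 1))) Q
    (h.subsingleton_ext_one hcoh hj) φ
  refine ⟨ψ, ?_⟩
  rw [← hφ, ← hψ]
  rfl

theorem DualExact.gProjDimLE_one (h : DualExact R) (hcoh : IsCoherentRing R)
    (hN : IsFinitelyPresented R N) : GProjDimLE R N 1 := by
  obtain ⟨n, l, hl, hfg⟩ := hN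
  have hfree (P : Type u) [AddCommGroup P] [Module R P] [Module.Finite R P] [Module.Free R P] :
      FiniteEmbedsInFree R P :=
    ⟨‹_›, P, _, _, LinearMap.id, ‹_›, ‹_›, Function.injective_id⟩
  have hK : FiniteEmbedsInFree R (LinearMap.ker l) :=
    ⟨.of_fg hfg, Fin n → R, _, _, Submodule.subtype _, inferInstance, inferInstance,
      Submodule.injective_subtype _⟩
  have := exists_resolution_of_exact (C := @IsGorensteinProjective R _)
    (hK.isGorensteinProjective h hcoh) ((hfree (Fin n → R)).isGorensteinProjective h hcoh)
    ((hfree PUnit.{u + 1}).isGorensteinProjective h hcoh) (Submodule.injective_subtype _)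
    (LinearMap.exact_subtype_ker_map l) hl
  unfold GProjDimLE
  exact this

end GorensteinProjective

/-- Proposition 3.3: characterizations of Gorenstein semihereditary rings among coherent
rings. -/
theorem statement_14 (R : Type u) [CommRing R] (hcoh : IsCoherentRing R) :
    List.TFAE
      [ ∀ (F : Type u) (_ : AddCommGroup F) (_ : Module R F), Module.Flat R F →
          ∀ N : Submodule R F, IsGorensteinFlat R N,
        ∀ (M : Type u) (_ : AddCommGroup M) (_ : Module R M), IsFinitelyPresented R M →
          GFlatDimLE R M 1,
        ∀ (M : Type u) (_ : AddCommGroup M) (_ : Module R M), IsFinitelyPresented R M →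
          GProjDimLE R M 1,
        ∀ I : Ideal R, I.FG → IsGorensteinFlat R I,
        ∀ (I : Type u) (_ : AddCommGroup I) (_ : Module R I), Module.Injective R I →
          FlatDimLE R I 1,
        ∀ (F : Type u) (_ : AddCommGroup F) (_ : Module R F), Module.Flat R F →
          ∀ (P : Type u) (_ : AddCommGroup P) (_ : Module R P), IsFinitelyPresented R P →
            ExtVanishes R P F 2,
        ∀ (E : Type u) (_ : AddCommGroup E) (_ : Module R E),
          (∀ (P : Type u) (_ : AddCommGroup P) (_ : Module R P), IsFinitelyPresented R P →
            ExtVanishes R P E 1) → FlatDimLE R E 1 ] := by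
  tfae_have 1 → 2 := fun h M _ _ _ => gFlatDimLE_one_of_forall_submodule h
  tfae_have 1 → 4 := fun h J _ => h R _ _ inferInstance J
  tfae_have 2 → 5 := fun h I _ _ _ => flatDimLE_one_of_gFlatDimLE_one h
  tfae_have 4 → 5 := fun h I _ _ _ => flatDimLE_one_of_isGorensteinFlat_ideal h
  tfae_have 5 → 1 := fun h F _ _ _ N =>
    EmbedsInFlat.isGorensteinFlat h
      ⟨F, _, _, N.subtype, ‹_›, Submodule.injective_subtype _⟩
  tfae_have 5 → 3 := fun h M _ _ hM => (dualExact_of_flatDimLE_one h).gProjDimLE_one hcoh hM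
  tfae_have 5 → 6 := fun h F _ _ _ P _ _ hP =>
    (dualExact_of_flatDimLE_one h).extVanishes_two hcoh hP
  tfae_have 3 → 7 := fun h E _ _ hE =>
    (dualExact_of_subsingleton_ext_two fun M _ _ hM =>
      GProjDimLE.subsingleton_ext_two
        (h M _ _ (isFinitelyPresented_iff.2 hM))).flatDimLE_one_of_fpInjective hcoh hE
  tfae_have 6 → 7 := fun h E _ _ hE =>
    (dualExact_of_subsingleton_ext_two fun M _ _ hM =>
      (extVanishes_succ_iff _ _ 1).1 (h R _ _ inferInstance M _ _
        (isFinitelyPresented_iff.2 hM))).flatDimLE_one_of_fpInjective hcoh hE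
  tfae_have 7 → 5 := fun h I _ _ _ =>
    h I _ _ fun P _ _ _ =>
      (extVanishes_succ_iff _ _ 0).2 (subsingleton_ext_of_injective _ _ 0)
  tfae_finish
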